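/- There exists a universal constant C' > 0 such that the following holds. Let N, q, h, T, L, M, U be positive integers, let X ∈ ℝ^{N×q}, and let Ā ∈ ℝ^{N×N} be a real symmetric matrix with eigenvalues λ_1, …, λ_N. Let σ : ℝ → ℝ be 1-Lipschitz with σ(0) = 0 and |σ(t)| ≤ R for all t ∈ ℝ. Fix nonnegative reals B^{(0)}, …, B^{(T+1)}, B^{(A)}, nonnegative reals θ_0, θ_1, …, θ_L, and μ ∈ [0,1]. For weight matrices W^{(0)} ∈ ℝ^{q×h}, W^{(1)}, …, W^{(T)} ∈ ℝ^{h×h}, W^{(A)} ∈ ℝ^{N×h}, W^{(T+1)} ∈ ℝ^{h×1} such that every column of W^{(l)} has ℓ1-norm at most B^{(l)} for l = 0, …, T+1 and every column of W^{(A)} has ℓ1-norm at most B^{(A)}, set X_T = σ(σ(⋯σ(X W^{(0)}) W^{(1)} ⋯) W^{(T-1)}) (σ applied entrywise, T layers) and f = (μ (θ_0 X_T + Σ_{k=1}^{L} θ_k Ā^k X_T (W^{(T)})^k) + (1−μ) Ā W^{(A)}) W^{(T+1)} ∈ ℝ^N. Let ε be a transductive Rademacher vector with parameter p₀ = MU/(M+U)².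 Then E_ε[ sup over all admissible weight tuples of |⟨ε, f⟩| ] ≤ C' B^{(T+1)} μ [ 2^T (∏_{l=0}^{T-1} B^{(l)}) √(2MU/(M+U)²) (θ_0 + Σ_{k=1}^{L} (B^{(T)})^k θ_k Σ_{j=1}^N |λ_j|^k) ‖X‖_F + (Σ_{k=1}^{L} (B^{(T)})^k θ_k Σ_{j=1}^N |λ_j|^k) √N R ] + (1−μ) 2^{5/2} B^{(T+1)} B^{(A)} (√(MU)/(M+U)) Σ_{i=1}^N |λ_i|. -/

import Mathlib

open Finset

/-- Expectation with respect to a transductive Rademacher vector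
`ε ∈ ℝ^N` with i.i.d. coordinates: `P(ε_i = 1) = P(ε_i = -1) = p`,
`P(ε_i = 0) = 1 - 2p`. -/
noncomputable def tExp (N : ℕ) (p : ℝ) (f : (Fin N → ℝ) → ℝ) : ℝ :=
  ∑ s : Fin N → Fin 3,
    (∏ i, (![p, p, 1 - 2 * p] : Fin 3 → ℝ) (s i)) *
      f (fun i => (![(1 : ℝ), -1, 0]) (s i))

/-- Frobenius norm of a real matrix. -/
noncomputable def frob {m n : ℕ} (X : Matrix (Fin m) (Fin n) ℝ) : ℝ :=
  Real.sqrt (∑ i, ∑ j, (X i j) ^ 2)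

/-- `mlp σ X W0 Ws t` is the output of a `(t+1)`-layer MLP with entrywise
activation `σ`: layer `0` is `σ(X W0)`, layer `k+1` multiplies by `Ws k`. -/
noncomputable def mlp {N q h : ℕ} (σ : ℝ → ℝ) (X : Matrix (Fin N) (Fin q) ℝ)
    (W0 : Matrix (Fin q) (Fin h) ℝ) (Ws : ℕ → Matrix (Fin h) (Fin h) ℝ) :
    ℕ → Matrix (Fin N) (Fin h) ℝ
  | 0 => Matrix.of fun i j => σ ((X * W0) i j)
  | (k + 1) => Matrix.of fun i j => σ ((mlp σ X W0 Ws k * Ws k) i j)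

open Matrix

/-! ### Elementary properties of the expectation `tExp` -/

section Expectation

variable {N : ℕ} {p : ℝ}

lemma tExp_mono (hp : 0 ≤ p) (hp' : p ≤ 1 / 2) {f g : (Fin N → ℝ) → ℝ} (hfg : ∀ ε, f ε ≤ g ε) :
    tExp N p f ≤ tExp N p g := by
  refine Finset.sum_le_sum fun s _ => mul_le_mul_of_nonneg_left (hfg _) ?_
  refine Finset.prod_nonneg fun i _ => ?_
  generalize s i = a
  fin_cases a <;> simp <;> linarith

lemma tExp_add (f g : (Fin N → ℝ) → ℝ) :
    tExp N p (fun ε => f ε + g ε) = tExp N p f + tExp N p g := by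
  simp only [tExp, mul_add, Finset.sum_add_distrib]

lemma tExp_const_mul (c : ℝ) (f : (Fin N → ℝ) → ℝ) :
    tExp N p (fun ε => c * f ε) = c * tExp N p f := by
  simp only [tExp, Finset.mul_sum]
  exact Finset.sum_congr rfl fun _ _ => by ring

lemma tExp_sum {ι : Type*} (S : Finset ι) (f : ι → (Fin N → ℝ) → ℝ) :
    tExp N p (fun ε => ∑ i ∈ S, f i ε) = ∑ i ∈ S, tExp N p (f i) := by
  simp only [tExp, Finset.mul_sum]
  exact Finset.sum_comm

lemma tExp_prod (g : Fin N → ℝ → ℝ) :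
    tExp N p (fun ε => ∏ i, g i (ε i)) = ∏ i, (p * g i 1 + p * g i (-1) + (1 - 2 * p) * g i 0) := by
  have h : ∀ i, p * g i 1 + p * g i (-1) + (1 - 2 * p) * g i 0 =
      ∑ a : Fin 3, (![p, p, 1 - 2 * p] : Fin 3 → ℝ) a * g i ((![(1 : ℝ), -1, 0]) a) := by
    intro i
    simp [Fin.sum_univ_three]
  simp only [tExp, h, Finset.prod_univ_sum, Fintype.piFinset_univ, Finset.prod_mul_distrib]

lemma tExp_one : tExp N p (fun _ => 1) = 1 := by
  have h := tExp_prod (N := N) (p := p) (fun _ _ => 1)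
  simp only [Finset.prod_const_one] at h
  rw [h]
  exact Finset.prod_eq_one fun _ _ => by ring

lemma tExp_const (c : ℝ) : tExp N p (fun _ => c) = c := by
  simpa [tExp_one] using tExp_const_mul (N := N) (p := p) c (fun _ => 1)

lemma tExp_coord_sq (n : Fin N) : tExp N p (fun ε => ε n ^ 2) = 2 * p := by
  have h := tExp_prod (N := N) (p := p) (fun i t => if i = n then t ^ 2 else 1)
  have h1 : ∀ ε : Fin N → ℝ, ∏ i, (if i = n then ε i ^ 2 else 1) = ε n ^ 2 := by
    intro ε
    simp [Finset.prod_ite_eq']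
  simp only [h1] at h
  rw [h, Finset.prod_eq_single n]
  · simp
    ring
  · intro b _ hb
    simp [hb]
    ring
  · simp

/-- The law of `ε` is invariant under changing the signs of any set of coordinates. -/
lemma tExp_neg_on (S : Finset (Fin N)) (f : (Fin N → ℝ) → ℝ) :
    tExp N p (fun ε => f (fun n => if n ∈ S then -ε n else ε n)) = tExp N p f := by
  let e : (Fin N → Fin 3) ≃ (Fin N → Fin 3) :=
    Equiv.piCongrRight fun n => if n ∈ S then Equiv.swap 0 1 else Equiv.refl _
  refine Fintype.sum_equiv e _ _ fun s => ?_
  congr 1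
  · refine Finset.prod_congr rfl fun n _ => ?_
    simp only [e, Equiv.piCongrRight_apply, Pi.map_apply]
    generalize s n = a
    split_ifs
    · fin_cases a <;> simp [Equiv.swap_apply_def]
    · rfl
  · refine congrArg f (funext fun n => ?_)
    simp only [e, Equiv.piCongrRight_apply, Pi.map_apply]
    generalize s n = a
    split_ifs
    · fin_cases a <;> simp [Equiv.swap_apply_def]
    · rfl

lemma tExp_neg (f : (Fin N → ℝ) → ℝ) : tExp N p (fun ε => f (-ε)) = tExp N p f := by
  simpa [Pi.neg_def] using tExp_neg_on (p := p) Finset.univ f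

lemma tExp_coord_mul {n m : Fin N} (hnm : n ≠ m) : tExp N p (fun ε => ε n * ε m) = 0 := by
  have h := tExp_neg_on (p := p) {n} (fun ε => ε n * ε m)
  simp only [Finset.mem_singleton, if_true, hnm.symm, if_false] at h
  have h2 := tExp_const_mul (N := N) (p := p) (-1) (fun ε => ε n * ε m)
  simp only [neg_mul, one_mul] at h2 h
  linarith

lemma tExp_dotProduct_sq (a : Fin N → ℝ) :
    tExp N p (fun ε => (ε ⬝ᵥ a) ^ 2) = 2 * p * ∑ n, a n ^ 2 := by
  have h : ∀ ε : Fin N → ℝ, (ε ⬝ᵥ a) ^ 2 = ∑ n, ∑ m, (a n * a m) * (ε n * ε m) := by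
    intro ε
    rw [dotProduct, sq, Finset.sum_mul_sum]
    exact Finset.sum_congr rfl fun _ _ => Finset.sum_congr rfl fun _ _ => by ring
  simp only [h, tExp_sum, tExp_const_mul]
  rw [Finset.mul_sum]
  refine Finset.sum_congr rfl fun n _ => ?_
  rw [Finset.sum_eq_single n]
  · have := tExp_coord_sq (p := p) n
    simp only [sq] at this ⊢
    rw [this]
    ring
  · intro m _ hm
    rw [tExp_coord_mul hm.symm, mul_zero]
  · simp

lemma tExp_sqrt_le (hp : 0 ≤ p) (hp' : p ≤ 1 / 2) {f : (Fin N → ℝ) → ℝ} (hf : ∀ ε, 0 ≤ f ε) :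
    tExp N p (fun ε => √(f ε)) ≤ √(tExp N p f) := by
  set c := tExp N p (fun ε => √(f ε))
  refine Real.le_sqrt_of_sq_le ?_
  have h : tExp N p (fun ε => 2 * c * √(f ε)) ≤ tExp N p (fun ε => f ε + c ^ 2) :=
    tExp_mono hp hp' fun ε => by nlinarith [sq_nonneg (√(f ε) - c), Real.sq_sqrt (hf ε)]
  rw [tExp_const_mul, tExp_add, tExp_const] at h
  change 2 * c * c ≤ tExp N p f + c ^ 2 at h
  linarith

lemma tExp_norm_vecMul_le (hp : 0 ≤ p) (hp' : p ≤ 1 / 2) {m : ℕ} (C : Matrix (Fin N) (Fin m) ℝ) :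
    tExp N p (fun ε => √(∑ j, (ε ᵥ* C) j ^ 2)) ≤ √(2 * p) * frob C := by
  refine (tExp_sqrt_le hp hp' fun ε => Finset.sum_nonneg fun j _ => sq_nonneg _).trans_eq ?_
  rw [frob, ← Real.sqrt_mul (by linarith), tExp_sum, Finset.sum_comm, Finset.mul_sum]
  exact congrArg _ (Finset.sum_congr rfl fun j _ => tExp_dotProduct_sq (fun i => C i j))

end Expectation

/-! ### Contraction and peeling -/

section Contraction

variable {N : ℕ} {p : ℝ}

lemma abs_dotProduct_le {m : ℕ} {u v : Fin m → ℝ} {a b : ℝ} (hu : ∀ i, |u i| ≤ a) (ha : 0 ≤ a)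
    (hv : ∑ i, |v i| ≤ b) : |u ⬝ᵥ v| ≤ a * b := by
  calc |u ⬝ᵥ v| ≤ ∑ i, |u i * v i| := Finset.abs_sum_le_sum_abs _ _
    _ ≤ ∑ i, a * |v i| := Finset.sum_le_sum fun i _ => by
      rw [abs_mul]
      exact mul_le_mul_of_nonneg_right (hu i) (abs_nonneg _)
    _ = a * ∑ i, |v i| := (Finset.mul_sum _ _ _).symm
    _ ≤ a * b := mul_le_mul_of_nonneg_left hv ha

lemma ciSup_add_ciSup_le_of_forall {ι κ : Type*} [Nonempty ι] [Nonempty κ] {a : ι → ℝ} {b : κ → ℝ}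
    {c : ℝ} (h : ∀ i j, a i + b j ≤ c) : (⨆ i, a i) + ⨆ j, b j ≤ c := by
  rw [← le_sub_iff_add_le]
  refine ciSup_le fun i => ?_
  rw [le_sub_comm]
  exact ciSup_le fun j => by linarith [h i j]

lemma bddAbove_range_abs_dotProduct {ι : Type*} {x : ι → Fin N → ℝ} {K : ℝ}
    (hx : ∀ i n, |x i n| ≤ K) (ε : Fin N → ℝ) : BddAbove (Set.range fun i => |ε ⬝ᵥ x i|) := by
  refine ⟨|K| * ∑ n, |ε n|, ?_⟩
  rintro _ ⟨i, rfl⟩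
  change |ε ⬝ᵥ x i| ≤ _
  rw [dotProduct_comm]
  exact abs_dotProduct_le (fun n => (hx i n).trans (le_abs_self K)) (abs_nonneg K) le_rfl

lemma bddAbove_range_dotProduct {ι : Type*} {x : ι → Fin N → ℝ} {K : ℝ}
    (hx : ∀ i n, |x i n| ≤ K) (ε : Fin N → ℝ) : BddAbove (Set.range fun i => ε ⬝ᵥ x i) := by
  obtain ⟨c, hc⟩ := bddAbove_range_abs_dotProduct hx ε
  refine ⟨c, ?_⟩
  rintro _ ⟨i, rfl⟩
  exact (le_abs_self _).trans (hc ⟨i, rfl⟩)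

/-- Contracting a single coordinate of a family of vectors does not increase the expected
supremum. -/
lemma tExp_iSup_le_of_contract_coord (hp : 0 ≤ p) (hp' : p ≤ 1 / 2) {ι : Type*} [Nonempty ι]
    {x : ι → Fin N → ℝ} {K : ℝ} (hx : ∀ i n, |x i n| ≤ K) (n : Fin N) (d : ι → ℝ)
    (hd : ∀ i j, |(x i n + d i) - (x j n + d j)| ≤ |x i n - x j n|) :
    tExp N p (fun ε => ⨆ i, ε ⬝ᵥ (x i + Pi.single n (d i))) ≤
      tExp N p (fun ε => ⨆ i, ε ⬝ᵥ x i) := by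
  have key : ∀ F : (Fin N → ℝ) → ℝ,
      tExp N p (fun ε => F ε + F (ε + Pi.single n (-2 * ε n))) = 2 * tExp N p F := by
    intro F
    rw [tExp_add, two_mul]
    congr 1
    rw [← tExp_neg_on {n} F]
    congr 1
    funext ε
    congr 1
    funext m
    by_cases hm : m = n
    · subst hm
      simp
      ring
    · simp [hm]
  have hmono := tExp_mono (N := N) hp hp'
    (f := fun ε => (⨆ i, ε ⬝ᵥ (x i + Pi.single n (d i))) +
      ⨆ i, (ε + Pi.single n (-2 * ε n)) ⬝ᵥ (x i + Pi.single n (d i)))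
    (g := fun ε => (⨆ i, ε ⬝ᵥ x i) + ⨆ i, (ε + Pi.single n (-2 * ε n)) ⬝ᵥ x i) ?_
  · have h1 := key fun ε : Fin N → ℝ => ⨆ i, ε ⬝ᵥ (x i + Pi.single n (d i) : Fin N → ℝ)
    have h2 := key fun ε : Fin N → ℝ => ⨆ i, ε ⬝ᵥ x i
    linarith
  · intro ε
    refine ciSup_add_ciSup_le_of_forall fun i j => ?_
    set ε' := ε + Pi.single n (-2 * ε n) with hε'
    have h1 := fun i => le_ciSup (bddAbove_range_dotProduct hx ε) i
    have h2 := fun i => le_ciSup (bddAbove_range_dotProduct hx ε') i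
    have e1 : ∀ i, ε' ⬝ᵥ x i = ε ⬝ᵥ x i - 2 * ε n * x i n := by
      intro i
      rw [hε', add_dotProduct, single_dotProduct]
      ring
    have e2 : ε' n = - ε n := by
      simp [hε']
      ring
    rw [dotProduct_add, dotProduct_add, dotProduct_single, dotProduct_single, e2]
    have hle : ε n * ((x i n + d i) - (x j n + d j)) ≤ |ε n * (x i n - x j n)| := by
      refine (le_abs_self _).trans ?_
      rw [abs_mul, abs_mul]
      exact mul_le_mul_of_nonneg_left (hd i j) (abs_nonneg _)
    rcases abs_cases (ε n * (x i n - x j n)) with ⟨h, _⟩ | ⟨h, _⟩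
    · have := h1 i
      have := h2 j
      rw [h] at hle
      linarith
    · have := h2 i
      have := h1 j
      have := e1 i
      have := e1 j
      rw [h] at hle
      linarith

/-- Contraction principle for transductive Rademacher vectors. -/
lemma tExp_iSup_comp_le (hp : 0 ≤ p) (hp' : p ≤ 1 / 2) {ι : Type*} [Nonempty ι]
    {x : ι → Fin N → ℝ} {K : ℝ} (hx : ∀ i n, |x i n| ≤ K) {σ : ℝ → ℝ}
    (hσ : ∀ s t, |σ s - σ t| ≤ |s - t|) (h0 : σ 0 = 0) :
    tExp N p (fun ε => ⨆ i, ε ⬝ᵥ (σ ∘ x i)) ≤ tExp N p (fun ε => ⨆ i, ε ⬝ᵥ x i) := by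
  suffices h : ∀ S : Finset (Fin N),
      tExp N p (fun ε => ⨆ i, ε ⬝ᵥ (fun n => if n ∈ S then σ (x i n) else x i n)) ≤
        tExp N p (fun ε => ⨆ i, ε ⬝ᵥ x i) by
    simpa [Function.comp_def] using h Finset.univ
  intro S
  induction S using Finset.induction_on with
  | empty => simp
  | insert m S hm ih =>
    refine le_trans (le_of_eq ?_) ((tExp_iSup_le_of_contract_coord hp hp'
      (x := fun i n => if n ∈ S then σ (x i n) else x i n) (K := K) ?_ m
      (fun i => σ (x i m) - x i m) ?_).trans ih)
    · congr 1
      funext ε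
      congr 1
      funext i
      congr 1
      funext n
      by_cases hn : n = m
      · subst hn
        simp [hm]
      · simp [hn]
    · intro i n
      split_ifs
      · have := hσ (x i n) 0
        rw [h0, sub_zero, sub_zero] at this
        exact this.trans (hx i n)
      · exact hx i n
    · intro i j
      simpa [hm] using hσ (x i m) (x j m)

/-- Contraction principle for suprema of absolute values. -/
lemma tExp_iSup_abs_comp_le (hp : 0 ≤ p) (hp' : p ≤ 1 / 2) {ι : Type*}
    {x : ι → Fin N → ℝ} {K : ℝ} (hx : ∀ i n, |x i n| ≤ K) {i₀ : ι} (hi₀ : x i₀ = 0) {σ : ℝ → ℝ}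
    (hσ : ∀ s t, |σ s - σ t| ≤ |s - t|) (h0 : σ 0 = 0) :
    tExp N p (fun ε => ⨆ i, |ε ⬝ᵥ (σ ∘ x i)|) ≤ 2 * tExp N p (fun ε => ⨆ i, |ε ⬝ᵥ x i|) := by
  have : Nonempty ι := ⟨i₀⟩
  have hσx : ∀ i n, |(σ ∘ x i) n| ≤ K := by
    intro i n
    have := hσ (x i n) 0
    rw [h0, sub_zero, sub_zero] at this
    exact this.trans (hx i n)
  have hz : ∀ ε, 0 ≤ ⨆ i, ε ⬝ᵥ (σ ∘ x i) := by
    intro ε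
    have h := le_ciSup (bddAbove_range_dotProduct hσx ε) i₀
    have hzero : σ ∘ x i₀ = 0 := by
      funext n
      simp [hi₀, h0]
    rwa [hzero, dotProduct_zero] at h
  have hsym : tExp N p (fun ε => ⨆ i, |ε ⬝ᵥ (σ ∘ x i)|) ≤
      tExp N p (fun ε => (⨆ i, ε ⬝ᵥ (σ ∘ x i)) + ⨆ i, (-ε) ⬝ᵥ (σ ∘ x i)) := by
    refine tExp_mono hp hp' fun ε => ciSup_le fun i => ?_
    have h1 := le_ciSup (bddAbove_range_dotProduct hσx ε) i
    have h2 := le_ciSup (bddAbove_range_dotProduct hσx (-ε)) i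
    have h3 := hz ε
    have h4 := hz (-ε)
    rw [neg_dotProduct] at h2
    exact abs_le'.2 ⟨by linarith, by linarith⟩
  rw [tExp_add, tExp_neg (fun ε => ⨆ i, ε ⬝ᵥ (σ ∘ x i)), ← two_mul] at hsym
  refine hsym.trans (mul_le_mul_of_nonneg_left ?_ zero_le_two)
  refine (tExp_iSup_comp_le hp hp' hx hσ h0).trans (tExp_mono hp hp' fun ε => ?_)
  exact ciSup_le fun i => (le_abs_self _).trans (le_ciSup (bddAbove_range_abs_dotProduct hx ε) i)

/-- Linear combinations of `m` vectors of `V` with coefficient vector of `ℓ1`-norm at most `b`. -/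
def ellOneComb (b : ℝ) (m : ℕ) (V : Set (Fin N → ℝ)) : Set (Fin N → ℝ) :=
  {x | ∃ (v : Fin m → ℝ) (y : Fin m → Fin N → ℝ),
    ∑ j, |v j| ≤ b ∧ (∀ j, y j ∈ V) ∧ x = fun n => (fun j => y j n) ⬝ᵥ v}

/-- The expected supremum of `|⟨ε, x⟩|` over `x ∈ V`. -/
noncomputable def tRad (p : ℝ) (V : Set (Fin N → ℝ)) : ℝ :=
  tExp N p (fun ε => ⨆ x : V, |ε ⬝ᵥ x.1|)

/-- Peeling off one layer with activation `σ`. -/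
lemma tRad_layer_le (hp : 0 ≤ p) (hp' : p ≤ 1 / 2) {V : Set (Fin N → ℝ)} (hV : V.Nonempty) {K : ℝ}
    (hK : ∀ x ∈ V, ∀ n, |x n| ≤ K) {b : ℝ} (hb : 0 ≤ b) (m : ℕ) {σ : ℝ → ℝ}
    (hσ : ∀ s t, |σ s - σ t| ≤ |s - t|) (h0 : σ 0 = 0) :
    tRad p ((σ ∘ ·) '' ellOneComb b m V) ≤ 2 * b * tRad p V := by
  obtain ⟨x₀, hx₀⟩ := hV
  have : Nonempty V := ⟨⟨x₀, hx₀⟩⟩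
  have hmem : (0 : Fin N → ℝ) ∈ ellOneComb b m V :=
    ⟨0, fun _ => x₀, by simpa using hb, fun _ => hx₀, by funext n; simp⟩
  have hbd : ∀ (x : ellOneComb b m V) n, |x.1 n| ≤ |K| * b := by
    rintro ⟨_, v, y, hv, hy, rfl⟩ n
    exact abs_dotProduct_le (fun j => (hK _ (hy j) n).trans (le_abs_self K)) (abs_nonneg K) hv
  have h1 : tRad p ((σ ∘ ·) '' ellOneComb b m V) =
      tExp N p (fun ε => ⨆ x : ellOneComb b m V, |ε ⬝ᵥ (σ ∘ x.1)|) := by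
    unfold tRad
    congr 1
    funext ε
    rw [← sSup_image' (f := fun x => |ε ⬝ᵥ x|), Set.image_image, sSup_image']
  rw [h1, mul_assoc, tRad]
  refine (tExp_iSup_abs_comp_le hp hp' hbd (i₀ := ⟨0, hmem⟩) rfl hσ h0).trans
    (mul_le_mul_of_nonneg_left ?_ zero_le_two)
  rw [← tExp_const_mul]
  have : Nonempty (ellOneComb b m V) := ⟨⟨0, hmem⟩⟩
  refine tExp_mono hp hp' fun ε => ciSup_le ?_
  rintro ⟨_, v, y, hv, hy, rfl⟩
  have hbV := bddAbove_range_abs_dotProduct (x := fun x : V => x.1) (fun x n => hK x.1 x.2 n) ε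
  have e : ε ⬝ᵥ (fun n => (fun j => y j n) ⬝ᵥ v) = (fun j => ε ⬝ᵥ y j) ⬝ᵥ v :=
    dotProduct_mulVec ε (Matrix.of fun n j => y j n) v
  change |ε ⬝ᵥ (fun n => (fun j => y j n) ⬝ᵥ v)| ≤ _
  rw [e, mul_comm]
  exact abs_dotProduct_le (fun j => le_ciSup hbV ⟨y j, hy j⟩)
    (Real.iSup_nonneg fun x => abs_nonneg _) hv

end Contraction

/-! ### The class of columns of a multilayer perceptron -/

section MLP

variable {N q : ℕ}

/-- A class of vectors containing every column of the output of the `(k+1)`-layer perceptron whose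
weights have columns of `ℓ1`-norm at most `B 0, …, B k`. -/
def mlpCols (σ : ℝ → ℝ) (X : Matrix (Fin N) (Fin q) ℝ) (B : ℕ → ℝ) (h : ℕ) :
    ℕ → Set (Fin N → ℝ)
  | 0 => (σ ∘ ·) '' ellOneComb (B 0) q (Set.range Xᵀ)
  | k + 1 => (σ ∘ ·) '' ellOneComb (B (k + 1)) h (mlpCols σ X B h k)

lemma mlp_col_mem_mlpCols {h : ℕ} {σ : ℝ → ℝ} {X : Matrix (Fin N) (Fin q) ℝ} {B : ℕ → ℝ}
    {W0 : Matrix (Fin q) (Fin h) ℝ} {Ws : ℕ → Matrix (Fin h) (Fin h) ℝ}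
    (hW0 : ∀ c, ∑ r, |W0 r c| ≤ B 0) (k : ℕ) (hWs : ∀ l < k, ∀ c, ∑ r, |Ws l r c| ≤ B (l + 1))
    (c : Fin h) : (fun n => mlp σ X W0 Ws k n c) ∈ mlpCols σ X B h k := by
  induction k generalizing c with
  | zero => exact ⟨_, ⟨fun r => W0 r c, Xᵀ, hW0 c, fun j => ⟨j, rfl⟩, rfl⟩, rfl⟩
  | succ k ih =>
    exact ⟨_, ⟨fun r => Ws k r c, fun j n => mlp σ X W0 Ws k n j, hWs k k.lt_succ_self c,
      fun j => ih (fun l hl => hWs l (hl.trans k.lt_succ_self)) j, rfl⟩, rfl⟩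

lemma abs_le_of_mem_mlpCols {h : ℕ} {σ : ℝ → ℝ} {X : Matrix (Fin N) (Fin q) ℝ} {B : ℕ → ℝ} {R : ℝ}
    (hR : ∀ t, |σ t| ≤ R) (k : ℕ) {x : Fin N → ℝ} (hx : x ∈ mlpCols σ X B h k) (n : Fin N) :
    |x n| ≤ R := by
  cases k <;>
  · obtain ⟨y, _, rfl⟩ := hx
    exact hR _

lemma mlpCols_nonempty {h : ℕ} {σ : ℝ → ℝ} {X : Matrix (Fin N) (Fin q) ℝ} {B : ℕ → ℝ} (hq : 0 < q)
    (k : ℕ) (hB : ∀ l ≤ k, 0 ≤ B l) : (mlpCols σ X B h k).Nonempty := by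
  induction k with
  | zero =>
    exact ⟨_, _, ⟨0, fun _ => Xᵀ ⟨0, hq⟩, by simpa using hB 0 le_rfl, fun _ => ⟨_, rfl⟩, rfl⟩, rfl⟩
  | succ k ih =>
    obtain ⟨y, hy⟩ := ih fun l hl => hB l (hl.trans k.le_succ)
    exact ⟨_, _, ⟨0, fun _ => y, by simpa using hB (k + 1) le_rfl, fun _ => hy, rfl⟩, rfl⟩

lemma tRad_range_transpose_le {p : ℝ} (hp : 0 ≤ p) (hp' : p ≤ 1 / 2)
    (X : Matrix (Fin N) (Fin q) ℝ) : tRad p (Set.range Xᵀ) ≤ √(2 * p) * frob X := by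
  refine (tExp_mono hp hp' fun ε => ?_).trans (tExp_norm_vecMul_le hp hp' X)
  refine Real.iSup_le ?_ (Real.sqrt_nonneg _)
  rintro ⟨_, j, rfl⟩
  exact Real.abs_le_sqrt
    (Finset.single_le_sum (f := fun j => (ε ᵥ* X) j ^ 2) (fun _ _ => sq_nonneg _)
      (Finset.mem_univ j))

lemma tRad_mlpCols_le {p : ℝ} (hp : 0 ≤ p) (hp' : p ≤ 1 / 2) {h : ℕ} {σ : ℝ → ℝ}
    {X : Matrix (Fin N) (Fin q) ℝ} {B : ℕ → ℝ} {R : ℝ} (hq : 0 < q)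
    (hσ : ∀ s t, |σ s - σ t| ≤ |s - t|) (h0 : σ 0 = 0) (hR : ∀ t, |σ t| ≤ R)
    (k : ℕ) (hB : ∀ l ≤ k, 0 ≤ B l) :
    tRad p (mlpCols σ X B h k) ≤
      2 ^ (k + 1) * (∏ l ∈ Finset.range (k + 1), B l) * (√(2 * p) * frob X) := by
  induction k with
  | zero =>
    have hXn : (Set.range Xᵀ).Nonempty := ⟨_, ⟨0, hq⟩, rfl⟩
    have hK : ∀ x ∈ Set.range Xᵀ, ∀ n, |x n| ≤ ∑ i, ∑ j, |X i j| := by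
      rintro _ ⟨j, rfl⟩ n
      exact (Finset.single_le_sum (f := fun j => |X n j|) (fun _ _ => abs_nonneg _)
        (Finset.mem_univ j)).trans (Finset.single_le_sum (f := fun i => ∑ j, |X i j|)
          (fun _ _ => Finset.sum_nonneg fun _ _ => abs_nonneg _) (Finset.mem_univ n))
    refine (tRad_layer_le hp hp' hXn hK (hB 0 le_rfl) q hσ h0).trans ?_
    rw [zero_add, pow_one, Finset.prod_range_one]
    exact mul_le_mul_of_nonneg_left (tRad_range_transpose_le hp hp' X)
      (mul_nonneg zero_le_two (hB 0 le_rfl))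
  | succ k ih =>
    have hB' : ∀ l ≤ k, 0 ≤ B l := fun l hl => hB l (hl.trans k.le_succ)
    refine (tRad_layer_le hp hp' (mlpCols_nonempty hq k hB')
      (fun x hx => abs_le_of_mem_mlpCols hR k hx) (hB (k + 1) le_rfl) h hσ h0).trans ?_
    refine (mul_le_mul_of_nonneg_left (ih hB')
      (mul_nonneg zero_le_two (hB (k + 1) le_rfl))).trans_eq ?_
    rw [Finset.prod_range_succ _ (k + 1), pow_succ _ (k + 1)]
    ring

end MLP

/-! ### Matrix estimates -/

section MatrixEstimates

lemma frob_pow_le {N : ℕ} {A : Matrix (Fin N) (Fin N) ℝ} (hA : A.IsHermitian) (k : ℕ) :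
    frob (A ^ k) ≤ ∑ j, |hA.eigenvalues j| ^ k := by
  have htr : ∑ i, ∑ j, (A ^ k) i j ^ 2 = (A ^ (k + k)).trace := by
    have hs : (A ^ k)ᵀ = A ^ k := by
      rw [transpose_pow]
      exact congrArg (· ^ k) (by simpa [IsHermitian] using hA)
    rw [pow_add]
    nth_rewrite 2 [← hs]
    simp only [trace, diag_apply, mul_apply, transpose_apply, sq]
    exact Finset.sum_comm
  have hspec : (A ^ (k + k)).trace = ∑ j, hA.eigenvalues j ^ (k + k) := by
    conv_lhs => rw [hA.spectral_theorem, ← map_pow, Unitary.conjStarAlgAut_apply, trace_mul_comm,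
      ← mul_assoc]
    simp [diagonal_pow, trace_diagonal]
  rw [frob, htr, hspec]
  refine Real.sqrt_le_iff.2 ⟨Finset.sum_nonneg fun j _ => by positivity, ?_⟩
  refine le_trans (le_of_eq (Finset.sum_congr rfl fun j _ => ?_))
    (Finset.sum_sq_le_sq_sum_of_nonneg (f := fun j => |hA.eigenvalues j| ^ k)
      fun j _ => by positivity)
  rw [pow_add, ← abs_pow, sq_abs, sq]

lemma abs_vecMul_pow_le {h : ℕ} {W : Matrix (Fin h) (Fin h) ℝ} {a b : ℝ} (ha : 0 ≤ a) (hb : 0 ≤ b)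
    (hW : ∀ c, ∑ r, |W r c| ≤ b) {u : Fin h → ℝ} (hu : ∀ i, |u i| ≤ a) (k : ℕ) (c : Fin h) :
    |(u ᵥ* W ^ k) c| ≤ a * b ^ k := by
  induction k generalizing c with
  | zero => simpa using hu c
  | succ k ih =>
    rw [pow_succ, ← vecMul_vecMul, pow_succ, ← mul_assoc]
    exact abs_dotProduct_le ih (by positivity) (hW c)

lemma abs_dotProduct_le_sqrt_mul {N : ℕ} {u x : Fin N → ℝ} {R : ℝ} (hR : 0 ≤ R)
    (hx : ∀ n, |x n| ≤ R) : |u ⬝ᵥ x| ≤ √(∑ n, u n ^ 2) * (√N * R) := by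
  have h1 : ∑ n, x n ^ 2 ≤ N * R ^ 2 := by
    calc ∑ n, x n ^ 2 ≤ ∑ _n : Fin N, R ^ 2 :=
          Finset.sum_le_sum fun n _ => sq_le_sq' (abs_le.1 (hx n)).1 (abs_le.1 (hx n)).2
      _ = N * R ^ 2 := by simp
  have h2 : √(N * R ^ 2) = √N * R := by
    rw [Real.sqrt_mul (Nat.cast_nonneg N), Real.sqrt_sq hR]
  rw [← h2, ← Real.sqrt_mul (Finset.sum_nonneg fun _ _ => sq_nonneg _)]
  refine Real.abs_le_sqrt ((Finset.sum_mul_sq_le_sq_mul_sq _ _ _).trans ?_)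
  exact mul_le_mul_of_nonneg_left h1 (Finset.sum_nonneg fun _ _ => sq_nonneg _)

lemma abs_apply_le_sqrt_sum_sq {N : ℕ} (u : Fin N → ℝ) (n : Fin N) : |u n| ≤ √(∑ n, u n ^ 2) :=
  Real.abs_le_sqrt (Finset.single_le_sum (f := fun n => u n ^ 2) (fun _ _ => sq_nonneg _)
    (Finset.mem_univ n))

end MatrixEstimates

/-- Pointwise bound on the output of the model in terms of bounds for its components. -/
lemma abs_dotProduct_model_le {N h L : ℕ} {A : Matrix (Fin N) (Fin N) ℝ}
    {H : Matrix (Fin N) (Fin h) ℝ} {WT : Matrix (Fin h) (Fin h) ℝ} {WA : Matrix (Fin N) (Fin h) ℝ}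
    {w : Fin h → ℝ} {θ : ℕ → ℝ} {μ b bT bA R g : ℝ} {ε : Fin N → ℝ}
    (hθ : ∀ k ≤ L, 0 ≤ θ k) (hμ : 0 ≤ μ) (hμ1 : μ ≤ 1) (hbT : 0 ≤ bT)
    (hR : 0 ≤ R) (hg : 0 ≤ g) (hH : ∀ n j, |H n j| ≤ R) (hHg : ∀ j, |ε ⬝ᵥ fun n => H n j| ≤ g)
    (hWT : ∀ c, ∑ r, |WT r c| ≤ bT) (hWA : ∀ c, ∑ r, |WA r c| ≤ bA) (hbA : 0 ≤ bA)
    (hw : ∑ r, |w r| ≤ b) :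
    |∑ n, ε n * ((μ • (θ 0 • H + ∑ k ∈ Finset.Icc 1 L, θ k • (A ^ k * H * WT ^ k))
        + (1 - μ) • (A * WA)).mulVec w) n| ≤
      b * (μ * (θ 0 * g + ∑ k ∈ Finset.Icc 1 L,
          bT ^ k * θ k * (√N * R) * √(∑ n, (ε ᵥ* A ^ k) n ^ 2))
        + (1 - μ) * bA * √(∑ n, (ε ᵥ* A ^ 1) n ^ 2)) := by
  change |ε ⬝ᵥ _| ≤ _
  rw [dotProduct_mulVec, mul_comm]
  have h1μ : 0 ≤ 1 - μ := by linarith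
  have hθ' : ∀ k ∈ Finset.Icc 1 L, 0 ≤ θ k := fun k hk => hθ k (Finset.mem_Icc.1 hk).2
  have hsum : 0 ≤ ∑ k ∈ Finset.Icc 1 L,
      bT ^ k * θ k * (√N * R) * √(∑ n, (ε ᵥ* A ^ k) n ^ 2) :=
    Finset.sum_nonneg fun k hk => by
      have := hθ' k hk
      positivity
  have hθ0 := hθ 0 (Nat.zero_le L)
  refine abs_dotProduct_le (fun j => ?_) (by positivity) hw
  have hexp : (ε ᵥ* (μ • (θ 0 • H + ∑ k ∈ Finset.Icc 1 L, θ k • (A ^ k * H * WT ^ k))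
        + (1 - μ) • (A * WA))) j =
      μ * (θ 0 * (ε ⬝ᵥ fun n => H n j) +
        ∑ k ∈ Finset.Icc 1 L, θ k * (((ε ᵥ* A ^ k) ᵥ* H) ᵥ* WT ^ k) j) +
      (1 - μ) * ((ε ᵥ* A ^ 1) ᵥ* WA) j := by
    simp only [vecMul_add, vecMul_smul, vecMul_sum, vecMul_vecMul, Pi.add_apply, Pi.smul_apply,
      Finset.sum_apply, smul_eq_mul, pow_one]
    rfl
  rw [hexp]
  refine (abs_add_le _ _).trans (add_le_add ?_ ?_)
  · rw [abs_mul, abs_of_nonneg hμ]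
    refine mul_le_mul_of_nonneg_left ((abs_add_le _ _).trans (add_le_add ?_ ?_)) hμ
    · rw [abs_mul, abs_of_nonneg hθ0]
      exact mul_le_mul_of_nonneg_left (hHg j) hθ0
    · refine (Finset.abs_sum_le_sum_abs _ _).trans (Finset.sum_le_sum fun k hk => ?_)
      rw [abs_mul, abs_of_nonneg (hθ' k hk)]
      have := abs_vecMul_pow_le (by positivity) hbT hWT
        (fun i => abs_dotProduct_le_sqrt_mul (u := ε ᵥ* A ^ k) hR fun n => hH n i) k j
      refine (mul_le_mul_of_nonneg_left this (hθ' k hk)).trans_eq ?_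
      ring
  · rw [abs_mul, abs_of_nonneg h1μ, mul_assoc, mul_comm bA]
    exact mul_le_mul_of_nonneg_left
      (abs_dotProduct_le (abs_apply_le_sqrt_sum_sq _) (Real.sqrt_nonneg _) (hWA j)) h1μ

/-- Theorem 2: Rademacher complexity bound for the AGPCN-LINK model. -/
theorem agpcn_link_rademacher_bound :
    ∃ C' : ℝ, 0 < C' ∧
      ∀ (N q h T L M U : ℕ), 0 < N → 0 < q → 0 < h → 0 < T → 0 < L → 0 < M → 0 < U →
      ∀ (X : Matrix (Fin N) (Fin q) ℝ) (A : Matrix (Fin N) (Fin N) ℝ)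
        (hA : A.IsHermitian) (σ : ℝ → ℝ) (R : ℝ),
        LipschitzWith 1 σ → σ 0 = 0 → (∀ t, |σ t| ≤ R) →
      ∀ (B : ℕ → ℝ) (BA : ℝ) (θ : ℕ → ℝ) (μ : ℝ),
        (∀ l ≤ T + 1, 0 ≤ B l) → 0 ≤ BA → (∀ k ≤ L, 0 ≤ θ k) → 0 ≤ μ → μ ≤ 1 →
      tExp N ((M : ℝ) * U / ((M : ℝ) + U) ^ 2) (fun ε =>
        sSup {y : ℝ | ∃ (W0 : Matrix (Fin q) (Fin h) ℝ)
            (Ws : ℕ → Matrix (Fin h) (Fin h) ℝ)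
            (WT : Matrix (Fin h) (Fin h) ℝ)
            (WA : Matrix (Fin N) (Fin h) ℝ)
            (w : Fin h → ℝ),
          (∀ c, ∑ r, |W0 r c| ≤ B 0) ∧
          (∀ l, l < T - 1 → ∀ c, ∑ r, |Ws l r c| ≤ B (l + 1)) ∧
          (∀ c, ∑ r, |WT r c| ≤ B T) ∧
          (∀ c, ∑ r, |WA r c| ≤ BA) ∧
          (∑ r, |w r| ≤ B (T + 1)) ∧
          y = |∑ n, ε n *
            ((μ • (θ 0 • mlp σ X W0 Ws (T - 1)
                + (∑ k ∈ Finset.Icc 1 L,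
                    θ k • (A ^ k * mlp σ X W0 Ws (T - 1) * WT ^ k)))
              + (1 - μ) • (A * WA)).mulVec w) n|})
      ≤ C' * B (T + 1) * μ *
          ((2 : ℝ) ^ T * (∏ l ∈ Finset.range T, B l) *
              Real.sqrt (2 * (M : ℝ) * U / ((M : ℝ) + U) ^ 2) *
              (θ 0 + (∑ k ∈ Finset.Icc 1 L,
                      (B T) ^ k * θ k * ∑ j, |hA.eigenvalues j| ^ k)) * frob X
            + (∑ k ∈ Finset.Icc 1 L,
                    (B T) ^ k * θ k * ∑ j, |hA.eigenvalues j| ^ k) *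
                Real.sqrt (N : ℝ) * R)
        + (1 - μ) * (2 : ℝ) ^ ((5 : ℝ) / 2) * B (T + 1) * BA *
            (Real.sqrt ((M : ℝ) * U) / ((M : ℝ) + U)) *
            ∑ i, |hA.eigenvalues i| := by
  refine ⟨1, one_pos, ?_⟩
  intro N q h T L M U hN hq hh hT hL hM hU X A hA σ R hσ h0 hR B BA θ μ hB hBA hθ hμ hμ1
  obtain ⟨t, rfl⟩ : ∃ t, T = t + 1 := ⟨T - 1, by omega⟩
  set p : ℝ := (M : ℝ) * U / ((M : ℝ) + U) ^ 2 with hp_def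
  have hM' : (0 : ℝ) < M := Nat.cast_pos.2 hM
  have hU' : (0 : ℝ) < U := Nat.cast_pos.2 hU
  have hp : 0 ≤ p := by positivity
  have hp' : p ≤ 1 / 2 := by
    rw [hp_def, div_le_div_iff₀ (by positivity) two_pos]
    nlinarith [sq_nonneg ((M : ℝ) - U), mul_pos hM' hU']
  have hσ' : ∀ s t, |σ s - σ t| ≤ |s - t| := fun s t => by
    simpa [Real.dist_eq] using hσ.dist_le_mul s t
  have hR0 : 0 ≤ R := (abs_nonneg _).trans (hR 0)
  have hBt : ∀ l ≤ t, 0 ≤ B l := fun l hl => hB l (by omega)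
  have hbT : 0 ≤ B (t + 1) := hB _ (by omega)
  have hb : 0 ≤ B (t + 1 + 1) := hB _ le_rfl
  have hθ0 := hθ 0 (Nat.zero_le L)
  have h1μ : 0 ≤ 1 - μ := by linarith
  have hθ' : ∀ k ∈ Finset.Icc 1 L, 0 ≤ θ k := fun k hk => hθ k (Finset.mem_Icc.1 hk).2
  set V := mlpCols σ X B h t
  rw [Nat.add_sub_cancel]
  refine (tExp_mono hp hp' (g := fun ε => B (t + 1 + 1) * (μ * (θ 0 * (⨆ x : V, |ε ⬝ᵥ x.1|) +
      ∑ k ∈ Finset.Icc 1 L,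
        B (t + 1) ^ k * θ k * (√N * R) * √(∑ n, (ε ᵥ* A ^ k) n ^ 2))
      + (1 - μ) * BA * √(∑ n, (ε ᵥ* A ^ 1) n ^ 2))) fun ε => ?_).trans ?_
  · have hg : 0 ≤ ⨆ x : V, |ε ⬝ᵥ x.1| := Real.iSup_nonneg fun x => abs_nonneg _
    refine Real.sSup_le ?_ ?_
    · rintro y ⟨W0, Ws, WT, WA, w, hW0, hWs, hWT, hWA, hw, rfl⟩
      have hmem := mlp_col_mem_mlpCols (σ := σ) (X := X) hW0 t hWs
      refine abs_dotProduct_model_le hθ hμ hμ1 hbT hR0 hg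
        (fun n j => abs_le_of_mem_mlpCols hR t (hmem j) n) (fun j => ?_) hWT hWA hBA hw
      exact le_ciSup (bddAbove_range_abs_dotProduct (x := fun x : V => x.1)
        (fun x n => abs_le_of_mem_mlpCols hR t x.2 n) ε) ⟨_, hmem j⟩
    · have : 0 ≤ ∑ k ∈ Finset.Icc 1 L,
          B (t + 1) ^ k * θ k * (√N * R) * √(∑ n, (ε ᵥ* A ^ k) n ^ 2) :=
        Finset.sum_nonneg fun k hk => by
          have := hθ' k hk
          positivity
      positivity
  simp only [tExp_const_mul, tExp_add, tExp_sum]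
  have hs : √(2 * p) ≤ 1 := Real.sqrt_le_one.2 (by linarith)
  have hE : ∀ k, tExp N p (fun ε => √(∑ n, (ε ᵥ* A ^ k) n ^ 2)) ≤
      √(2 * p) * ∑ j, |hA.eigenvalues j| ^ k := fun k =>
    (tExp_norm_vecMul_le hp hp' (A ^ k)).trans
      (mul_le_mul_of_nonneg_left (frob_pow_le hA k) (Real.sqrt_nonneg _))
  have hRad : tExp N p (fun ε => ⨆ x : V, |ε ⬝ᵥ x.1|) ≤ _ :=
    tRad_mlpCols_le (h := h) (X := X) hp hp' hq hσ' h0 hR t hBt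
  have hfrob : 0 ≤ frob X := Real.sqrt_nonneg _
  have hprod : 0 ≤ ∏ l ∈ Finset.range (t + 1), B l :=
    Finset.prod_nonneg fun l hl => hBt l (Nat.lt_succ_iff.1 (Finset.mem_range.1 hl))
  set P := ∏ l ∈ Finset.range (t + 1), B l
  have hsumE : ∑ k ∈ Finset.Icc 1 L, B (t + 1) ^ k * θ k * (√N * R) *
        tExp N p (fun ε => √(∑ n, (ε ᵥ* A ^ k) n ^ 2)) ≤
      (∑ k ∈ Finset.Icc 1 L, B (t + 1) ^ k * θ k * ∑ j, |hA.eigenvalues j| ^ k) * √N * R := by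
    rw [Finset.sum_mul, Finset.sum_mul]
    refine Finset.sum_le_sum fun k hk => ?_
    have := hθ' k hk
    refine (mul_le_mul_of_nonneg_left ((hE k).trans
      (mul_le_of_le_one_left (Finset.sum_nonneg fun j _ => by positivity) hs))
      (by positivity)).trans_eq ?_
    ring
  have hD : 0 ≤ ∑ k ∈ Finset.Icc 1 L, B (t + 1) ^ k * θ k * ∑ j, |hA.eigenvalues j| ^ k :=
    Finset.sum_nonneg fun k hk => by
      have := hθ' k hk
      positivity
  set D := ∑ k ∈ Finset.Icc 1 L, B (t + 1) ^ k * θ k * ∑ j, |hA.eigenvalues j| ^ k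
  have hsq : √(2 * p) ≤ 2 ^ ((5 : ℝ) / 2) * (√((M : ℝ) * U) / ((M : ℝ) + U)) := by
    rw [Real.sqrt_mul zero_le_two, hp_def, Real.sqrt_div (by positivity),
      Real.sqrt_sq (by positivity), Real.sqrt_eq_rpow 2]
    exact mul_le_mul_of_nonneg_right
      (Real.rpow_le_rpow_of_exponent_le one_le_two (by norm_num)) (by positivity)
  have hlink : tExp N p (fun ε => √(∑ n, (ε ᵥ* A ^ 1) n ^ 2)) ≤
      2 ^ ((5 : ℝ) / 2) * (√((M : ℝ) * U) / ((M : ℝ) + U)) * ∑ j, |hA.eigenvalues j| := by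
    refine (hE 1).trans ?_
    simp only [pow_one]
    exact mul_le_mul_of_nonneg_right hsq (Finset.sum_nonneg fun j _ => abs_nonneg _)
  have e2p : 2 * (M : ℝ) * U / ((M : ℝ) + U) ^ 2 = 2 * p := by
    rw [hp_def]
    ring
  rw [e2p]
  have hmain : θ 0 * tExp N p (fun ε => ⨆ x : V, |ε ⬝ᵥ x.1|) ≤
      2 ^ (t + 1) * P * √(2 * p) * (θ 0 + D) * frob X := by
    refine (mul_le_mul_of_nonneg_left hRad hθ0).trans ?_
    have : 0 ≤ 2 ^ (t + 1) * P * √(2 * p) * D * frob X := by positivity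
    linarith
  refine (mul_le_mul_of_nonneg_left (add_le_add
    (mul_le_mul_of_nonneg_left (add_le_add hmain hsumE) hμ)
    (mul_le_mul_of_nonneg_left hlink (mul_nonneg h1μ hBA))) hb).trans_eq ?_
  ring
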